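/- arXiv:2412.01209 — 2 statements merged into one kernel-verified Lean document; each statement's English description precedes it below -/
import Mathlib

section
/- Let d ≥ 1, let V satisfy Assumption (A), and fix ν > 1/2. For R ≥ 1 set f_R(x, ξ) = ⟨x/R⟩^(−2ν) (R² + p(x, ξ))^(1/2). Then for every integer k ≥ 1 there exists C_k > 0, independent of R, such that for all R ≥ 1 and all ρ ∈ ℝ^{2d}: ‖D^k f_R(ρ)‖ ≤ C_k R^(−1) f_R(ρ). In particular ∇f_R belongs to the symbol class S(R^(−1) f_R) uniformly with respect to R ≥ 1. -/
open Real MeasureTheory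

noncomputable section

abbrev E (d : ℕ) := EuclideanSpace ℝ (Fin d)

/-- Assumption (A): `V` is smooth, nonnegative, comparable to `⟨x⟩^{2m}` with `m ∈ (0,1]`,
with derivative bounds `‖D^k V(x)‖ ≤ C_k ⟨x⟩^{2m-k}`. Here `⟨x⟩^s = (1+‖x‖²)^{s/2}`. -/
def AssumptionA {d : ℕ} (V : E d → ℝ) (m : ℝ) : Prop :=
  ContDiff ℝ (⊤ : ℕ∞) V ∧ (∀ x, 0 ≤ V x) ∧ 0 < m ∧ m ≤ 1 ∧
  (∃ C > 0, ∀ x : E d, C⁻¹ * (1 + ‖x‖ ^ 2) ^ m - C ≤ V x ∧ V x ≤ C * (1 + ‖x‖ ^ 2) ^ m) ∧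
  (∀ k : ℕ, ∃ Ck > 0, ∀ x : E d,
    ‖iteratedFDeriv ℝ k V x‖ ≤ Ck * (1 + ‖x‖ ^ 2) ^ (m - (k : ℝ) / 2))

/-- The classical Hamiltonian `p(x,ξ) = ½|ξ|² + V(x)`. -/
def ham {d : ℕ} (V : E d → ℝ) (ρ : E d × E d) : ℝ := (1 / 2) * ‖ρ.2‖ ^ 2 + V ρ.1

/-- The weight `f_R(x,ξ) = ⟨x/R⟩^{-2ν} (R² + p(x,ξ))^{1/2}`. -/
def fR {d : ℕ} (V : E d → ℝ) (ν R : ℝ) (ρ : E d × E d) : ℝ :=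
  (1 + ‖R⁻¹ • ρ.1‖ ^ 2) ^ (-ν) * Real.sqrt (R ^ 2 + ham V ρ)

open scoped ContDiff

lemma clm_iter {F G : Type*} [NormedAddCommGroup F] [NormedSpace ℝ F] [NormedAddCommGroup G]
    [NormedSpace ℝ G] (L : F →L[ℝ] G) (n : ℕ) (x : F) :
    ‖iteratedFDeriv ℝ n (fun y => L y) x‖ ≤ ‖L‖ * (1 + ‖x‖) := by
  have h0 := norm_nonneg L
  have h1 := norm_nonneg x
  match n with
  | 0 =>
    rw [norm_iteratedFDeriv_zero]
    nlinarith [L.le_opNorm x]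
  | n + 1 =>
    rw [← norm_iteratedFDeriv_fderiv]
    have : fderiv ℝ (fun y => L y) = fun _ => L := by ext1 y; exact L.fderiv
    rw [this]
    match n with
    | 0 => rw [norm_iteratedFDeriv_zero]; nlinarith
    | n + 1 =>
      rw [iteratedFDeriv_succ_const]
      simp only [Pi.zero_apply, norm_zero]
      positivity

lemma normsq_iter {F : Type*} [NormedAddCommGroup F] [InnerProductSpace ℝ F] (n : ℕ) (hn : 1 ≤ n)
    (x : F) : ‖iteratedFDeriv ℝ n (fun y : F => ‖y‖ ^ 2) x‖ ≤ 2 * (1 + ‖x‖) := by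
  obtain ⟨n, rfl⟩ : ∃ k, n = k + 1 := ⟨n - 1, by omega⟩
  rw [← norm_iteratedFDeriv_fderiv]
  have : fderiv ℝ (fun y : F => ‖y‖ ^ 2) = fun y => ((2 : ℝ) • innerSLFlip ℝ (E := F)) y := by
    rw [fderiv_norm_sq]
    ext y z
    have h : innerSLFlip ℝ y z = inner ℝ z y := innerSLFlip_apply_apply _ _ _
    simp [h, real_inner_comm, two_mul]
  rw [this]
  refine (clm_iter _ n x).trans ?_
  gcongr
  refine ContinuousLinearMap.opNorm_le_bound _ (by norm_num) fun y => ?_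
  refine ContinuousLinearMap.opNorm_le_bound _ (by positivity) fun z => ?_
  simp only [_root_.smul_apply, innerSLFlip_apply_apply, smul_eq_mul, norm_mul,
    Real.norm_ofNat]
  rw [mul_assoc, mul_comm ‖y‖]
  gcongr
  exact norm_inner_le_norm _ _

lemma comp_iter {F G : Type*} [NormedAddCommGroup F] [NormedSpace ℝ F] [NormedAddCommGroup G]
    [NormedSpace ℝ G] (L : F →L[ℝ] G) {f : G → ℝ} (hf : ContDiff ℝ ∞ f) (n : ℕ) (x : F) :
    ‖iteratedFDeriv ℝ n (fun y => f (L y)) x‖ ≤ ‖iteratedFDeriv ℝ n f (L x)‖ * ‖L‖ ^ n := by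
  have := L.iteratedFDeriv_comp_right hf x (i := n) (by exact_mod_cast le_top)
  change ‖iteratedFDeriv ℝ n (f ∘ L) x‖ ≤ _
  rw [this]
  refine (ContinuousMultilinearMap.norm_compContinuousLinearMap_le _ _).trans ?_
  simp

lemma add_const_iter {F : Type*} [NormedAddCommGroup F] [NormedSpace ℝ F] (f : F → ℝ) (c : ℝ)
    (n : ℕ) (hn : 1 ≤ n) :
    iteratedFDeriv ℝ n (fun y => f y + c) = iteratedFDeriv ℝ n f := by
  obtain ⟨n, rfl⟩ : ∃ k, n = k + 1 := ⟨n - 1, by omega⟩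
  have : fderiv ℝ (fun y => f y + c) = fderiv ℝ f := by ext1 y; exact fderiv_add_const c
  ext1 x
  rw [iteratedFDeriv_succ_eq_comp_right, iteratedFDeriv_succ_eq_comp_right, this]

lemma pow_iter {F : Type*} [NormedAddCommGroup F] [NormedSpace ℝ F] (a : ℝ) (n : ℕ) (hn : 1 ≤ n)
    (B : ℝ) (hB : 1 ≤ B) : ∃ C > 0, ∀ P : F → ℝ, ContDiff ℝ ∞ P → (∀ x, 0 < P x) → ∀ x μ,
      0 < μ → μ ≤ 1 → (∀ i, 1 ≤ i → i ≤ n → ‖iteratedFDeriv ℝ i P x‖ ≤ B * μ * P x) →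
      ‖iteratedFDeriv ℝ n (fun y => P y ^ a) x‖ ≤ C * μ * P x ^ a := by
  set K : ℝ := ∑ k ∈ Finset.range (n + 1), ‖Polynomial.eval a (descPochhammer ℝ k)‖ with hK
  have hK0 : 0 ≤ K := by positivity
  refine ⟨n.factorial * (K + 1) * B ^ n, by positivity, ?_⟩
  intro P hP hpos x μ hμ hμ1 hD
  have hP0 := hpos x
  set P0 := P x with hP0d
  have ha : 0 < P0 ^ a := by positivity
  set c := (μ * P0) ^ a with hc
  have hc0 : 0 < c := by positivity
  set g : ℝ → ℝ := fun t => c * t ^ a + (-P0 ^ a) with hg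
  set f : F → ℝ := fun y => (μ * P0)⁻¹ • P y with hf
  have hfc : ContDiff ℝ ∞ f := hP.const_smul _
  have hfpos : ∀ y, 0 < f y := fun y => by
    have := hpos y
    simp only [hf, smul_eq_mul]; positivity
  have hgc : ContDiffOn ℝ ∞ g (Set.Ioi 0) :=
    (contDiffOn_const.mul (contDiffOn_fun_id.rpow_const_of_ne fun x hx ↦ (ne_of_gt hx))).add
      contDiffOn_const
  have hu : UniqueDiffOn ℝ (Set.Ioi (0 : ℝ)) := isOpen_Ioi.uniqueDiffOn
  have hfx : f x = μ⁻¹ := by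
    simp only [hf, smul_eq_mul, ← hP0d]; field_simp
  have hgf : (g ∘ f) = fun y => P y ^ a + (-P0 ^ a) := by
    ext y
    simp only [hg, Function.comp, hc]
    rw [← Real.mul_rpow (by positivity) (hfpos y).le]
    congr 2
    simp only [hf, smul_eq_mul]; field_simp
  have key := norm_iteratedFDeriv_comp_le' (𝕜 := ℝ) (g := g) (f := f) (n := n) (N := ∞)
    (t := Set.Ioi 0) (by rintro _ ⟨y, rfl⟩; exact hfpos y) hu hgc hfc
    (by exact_mod_cast le_top) x (C := K * μ * P0 ^ a) (D := B) ?_ ?_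
  · rw [hgf, add_const_iter _ _ n hn] at key
    refine key.trans ?_
    have : n.factorial * (K * μ * P0 ^ a) * B ^ n = n.factorial * K * B ^ n * μ * P0 ^ a := by ring
    rw [this]
    gcongr
    linarith
  · intro i hi
    have hx : f x ∈ Set.Ioi (0:ℝ) := hfpos x
    rcases Nat.eq_zero_or_pos i with rfl | hi0
    · rw [norm_iteratedFDerivWithin_zero]
      have : g (f x) = 0 := by
        have := congrFun hgf x
        simp only [Function.comp] at this
        rw [this, ← hP0d]; ring
      rw [this, norm_zero]; positivity
    · rw [iteratedFDerivWithin_of_isOpen i isOpen_Ioi hx, hg, add_const_iter _ _ i hi0,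
        norm_iteratedFDeriv_eq_norm_iteratedDeriv, iteratedDeriv_const_mul_field, iteratedDeriv_eq_iterate,
        Real.iter_deriv_rpow_const, hfx, norm_mul, norm_mul]
      have h1 : ‖Polynomial.eval a (descPochhammer ℝ i)‖ ≤ K :=
        Finset.single_le_sum (f := fun k => ‖Polynomial.eval a (descPochhammer ℝ k)‖)
          (fun _ _ ↦ by positivity) (by simp; omega)
      have h2 : ‖c‖ * ‖μ⁻¹ ^ (a - i)‖ = μ ^ i * P0 ^ a := by
        rw [Real.norm_of_nonneg hc0.le, Real.norm_of_nonneg (by positivity), hc,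
          Real.mul_rpow hμ.le hP0.le, Real.inv_rpow hμ.le, Real.rpow_sub hμ, Real.rpow_natCast]
        have : 0 < μ ^ a := by positivity
        field_simp
      have h3 : μ ^ i ≤ μ := by
        simpa using pow_le_pow_of_le_one hμ.le hμ1 hi0
      calc _ = ‖Polynomial.eval a (descPochhammer ℝ i)‖ * (‖c‖ * ‖μ⁻¹ ^ (a - i)‖) := by ring
        _ = ‖Polynomial.eval a (descPochhammer ℝ i)‖ * (μ ^ i * P0 ^ a) := by rw [h2]
        _ ≤ K * (μ * P0 ^ a) := by gcongr
        _ = _ := by ring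
  · intro i h1 hi
    rw [hf, iteratedFDeriv_const_smul_apply' (hP.contDiffAt.of_le (by exact_mod_cast le_top)),
      norm_smul, Real.norm_of_nonneg (by positivity)]
    calc _ ≤ (μ * P0)⁻¹ * (B * μ * P0) := by gcongr; exact hD i h1 hi
      _ = B := by field_simp
      _ ≤ B ^ i := by simpa using pow_le_pow_right₀ hB h1

lemma bracket_iter {d : ℕ} (ν : ℝ) (n : ℕ) : ∃ C > 0, ∀ R : ℝ, 1 ≤ R → ∀ ρ : E d × E d,
    ‖iteratedFDeriv ℝ n (fun ρ : E d × E d => (1 + ‖R⁻¹ • ρ.1‖ ^ 2) ^ (-ν)) ρ‖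
        ≤ C * (1 + ‖R⁻¹ • ρ.1‖ ^ 2) ^ (-ν) ∧
    (1 ≤ n → ‖iteratedFDeriv ℝ n (fun ρ : E d × E d => (1 + ‖R⁻¹ • ρ.1‖ ^ 2) ^ (-ν)) ρ‖
        ≤ C * R⁻¹ * (1 + ‖R⁻¹ • ρ.1‖ ^ 2) ^ (-ν)) := by
  rcases Nat.eq_zero_or_pos n with rfl | hn
  · refine ⟨1, one_pos, fun R hR ρ => ⟨?_, by simp⟩⟩
    rw [norm_iteratedFDeriv_zero, Real.norm_of_nonneg (by positivity), one_mul]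
  obtain ⟨C, hC, H⟩ := pow_iter (F := E d) (-ν) n hn 4 (by norm_num)
  have hcd : ContDiff ℝ ∞ (fun y : E d => 1 + ‖y‖ ^ 2) := contDiff_const.add (contDiff_norm_sq ℝ)
  have H1 : ∀ y : E d, ‖iteratedFDeriv ℝ n (fun y : E d => (1 + ‖y‖ ^ 2) ^ (-ν)) y‖
      ≤ C * (1 + ‖y‖ ^ 2) ^ (-ν) := by
    intro y
    have := H (fun y => 1 + ‖y‖ ^ 2) hcd (fun y => by positivity) y 1 one_pos le_rfl ?_
    · simpa using this
    · intro i hi _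
      have h2 : (fun y : E d => 1 + ‖y‖ ^ 2) = fun y => ‖y‖ ^ 2 + 1 := by ext; ring
      rw [h2, add_const_iter _ _ i hi]
      refine (normsq_iter i hi y).trans ?_
      nlinarith [sq_nonneg (‖y‖ - 1)]
  refine ⟨C, hC, fun R hR ρ => ?_⟩
  have hR0 : 0 < R := by linarith
  have hRi : R⁻¹ ≤ 1 := inv_le_one_of_one_le₀ hR
  set L : E d × E d →L[ℝ] E d := R⁻¹ • ContinuousLinearMap.fst ℝ (E d) (E d) with hL
  have hLn : ‖L‖ ≤ R⁻¹ := by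
    rw [hL, norm_smul, Real.norm_of_nonneg (by positivity)]
    have := ContinuousLinearMap.norm_fst_le ℝ (E d) (E d)
    nlinarith [inv_pos.2 hR0]
  have hG : ContDiff ℝ ∞ (fun y : E d => (1 + ‖y‖ ^ 2) ^ (-ν)) :=
    hcd.rpow_const_of_ne fun y => by positivity
  have h := comp_iter L hG n ρ
  have hw : 0 < (1 + ‖R⁻¹ • ρ.1‖ ^ 2) ^ (-ν) := by positivity
  have main : ‖iteratedFDeriv ℝ n (fun ρ : E d × E d => (1 + ‖R⁻¹ • ρ.1‖ ^ 2) ^ (-ν)) ρ‖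
        ≤ C * R⁻¹ * (1 + ‖R⁻¹ • ρ.1‖ ^ 2) ^ (-ν) := by
    have h3 : ‖L‖ ^ n ≤ R⁻¹ := by
      calc ‖L‖ ^ n ≤ R⁻¹ ^ n := by gcongr
        _ ≤ R⁻¹ := by simpa using pow_le_pow_of_le_one (inv_pos.2 hR0).le hRi hn
    calc _ ≤ _ := h
      _ ≤ (C * (1 + ‖L ρ‖ ^ 2) ^ (-ν)) * R⁻¹ := by
        gcongr
        exact H1 _
      _ = C * R⁻¹ * (1 + ‖R⁻¹ • ρ.1‖ ^ 2) ^ (-ν) := by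
        simp only [hL, _root_.smul_apply, ContinuousLinearMap.coe_fst']
        ring
  refine ⟨main.trans ?_, fun _ => main⟩
  gcongr
  nlinarith

lemma ham_contDiff {d : ℕ} {V : E d → ℝ} {m : ℝ} (hV : AssumptionA V m) :
    ContDiff ℝ ∞ (ham V) := by
  have h1 : ContDiff ℝ ∞ V := hV.1
  exact (contDiff_const.mul ((contDiff_norm_sq ℝ).comp contDiff_snd)).add (h1.comp contDiff_fst)

lemma ham_iter {d : ℕ} {V : E d → ℝ} {m : ℝ} (hV : AssumptionA V m) (n : ℕ) :
    ∃ B ≥ 1, ∀ R : ℝ, 1 ≤ R → ∀ i, 1 ≤ i → i ≤ n → ∀ ρ : E d × E d,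
    ‖iteratedFDeriv ℝ i (fun ρ => R ^ 2 + ham V ρ) ρ‖ ≤ B * √(R ^ 2 + ham V ρ) := by
  have hcd := ham_contDiff hV
  obtain ⟨hs, hpos, hm0, hm1, ⟨C, hC, hCV⟩, hk⟩ := hV
  choose c hc hcV using hk
  have hs : ContDiff ℝ ∞ V := hs
  have hS : 0 ≤ ∑ i ∈ Finset.range (n + 1), c i := Finset.sum_nonneg fun i _ => (hc i).le
  refine ⟨3 + (∑ i ∈ Finset.range (n + 1), c i) * √(C * (C + 1)), ?_, ?_⟩
  · have : 0 ≤ (∑ i ∈ Finset.range (n + 1), c i) * √(C * (C + 1)) := by positivity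
    linarith
  intro R hR i hi hin ρ
  have e1 : (fun ρ => R ^ 2 + ham V ρ) = fun ρ => ham V ρ + R ^ 2 := by ext; ring
  set P := R ^ 2 + ham V ρ with hP
  have hVx := hpos ρ.1
  have hP1 : 1 ≤ P := by
    have : 0 ≤ ham V ρ := by unfold ham; positivity
    nlinarith
  have hPV : V ρ.1 ≤ P := by
    have : V ρ.1 ≤ ham V ρ := by unfold ham; nlinarith [sq_nonneg ‖ρ.2‖]
    nlinarith
  have hPx : ‖ρ.2‖ ^ 2 ≤ 2 * P := by
    have : (1/2) * ‖ρ.2‖ ^ 2 ≤ ham V ρ := by unfold ham; linarith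
    nlinarith
  have hsq : √P ^ 2 = P := Real.sq_sqrt (by linarith)
  have hs1 : 1 ≤ √P := Real.one_le_sqrt.2 hP1
  rw [e1, add_const_iter _ _ i hi]
  have e2 : ham V = (fun ρ : E d × E d => (1 / 2 : ℝ) • ‖ContinuousLinearMap.snd ℝ (E d) (E d) ρ‖ ^ 2)
      + (fun ρ => V (ContinuousLinearMap.fst ℝ (E d) (E d) ρ)) := rfl
  have hle : ((i : ℕ) : WithTop ℕ∞) ≤ ∞ := by exact_mod_cast le_top
  have hq : ContDiff ℝ ∞ (fun ρ : E d × E d => ‖ContinuousLinearMap.snd ℝ (E d) (E d) ρ‖ ^ 2) :=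
    (contDiff_norm_sq ℝ).comp contDiff_snd
  have hv : ContDiff ℝ ∞ (fun ρ : E d × E d => V (ContinuousLinearMap.fst ℝ (E d) (E d) ρ)) :=
    hs.comp contDiff_fst
  rw [e2, iteratedFDeriv_add_apply ((hq.const_smul (1/2 : ℝ)).contDiffAt.of_le hle)
    (hv.contDiffAt.of_le hle), iteratedFDeriv_const_smul_apply' (hq.contDiffAt.of_le hle)]
  refine (norm_add_le _ _).trans ?_
  rw [norm_smul, add_mul]
  refine add_le_add ?_ ?_
  · have h1 := comp_iter (ContinuousLinearMap.snd ℝ (E d) (E d)) (contDiff_norm_sq ℝ (E := E d)) i ρ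
    have h2 := normsq_iter i hi ρ.2
    have h3 : ‖ContinuousLinearMap.snd ℝ (E d) (E d)‖ ^ i ≤ 1 :=
      pow_le_one₀ (norm_nonneg _) (ContinuousLinearMap.norm_snd_le ℝ (E d) (E d))
    have h4 := h1.trans (mul_le_of_le_one_right (norm_nonneg _) h3)
    have h5 := h4.trans h2
    have h6 : ‖ρ.2‖ ≤ 2 * √P := by
      apply abs_le_of_sq_le_sq' _ (by positivity) |>.2
      nlinarith
    have h7 : ‖(1 / 2 : ℝ)‖ = 1 / 2 := by norm_num
    rw [h7]
    linarith
  · have h1 := comp_iter (ContinuousLinearMap.fst ℝ (E d) (E d)) hs i ρ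
    have h3 : ‖ContinuousLinearMap.fst ℝ (E d) (E d)‖ ^ i ≤ 1 :=
      pow_le_one₀ (norm_nonneg _) (ContinuousLinearMap.norm_fst_le ℝ (E d) (E d))
    have h4 := h1.trans (mul_le_of_le_one_right (norm_nonneg _) h3)
    refine h4.trans ((hcV i ρ.1).trans ?_)
    rw [mul_assoc]
    have h5 : c i ≤ ∑ i ∈ Finset.range (n + 1), c i :=
      Finset.single_le_sum (f := c) (fun j _ => (hc j).le) (by simp; omega)
    have hb : 1 ≤ 1 + ‖ρ.1‖ ^ 2 := by nlinarith [sq_nonneg ‖ρ.1‖]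
    have hi' : (1 : ℝ) ≤ i := by exact_mod_cast hi
    have h6 : (1 + ‖ρ.1‖ ^ 2) ^ (m - (i : ℝ) / 2) ≤ (1 + ‖ρ.1‖ ^ 2) ^ (m * (1 / 2)) :=
      Real.rpow_le_rpow_of_exponent_le hb (by linarith)
    have h7 : (1 + ‖ρ.1‖ ^ 2) ^ (m * (1 / 2)) ≤ √(C * (C + 1)) * √P := by
      rw [Real.rpow_mul (by positivity), ← Real.sqrt_eq_rpow, ← Real.sqrt_mul (by positivity)]
      apply Real.sqrt_le_sqrt
      have h8 := (hCV ρ.1).1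
      have h9 : C⁻¹ * (1 + ‖ρ.1‖ ^ 2) ^ m ≤ P + C := by linarith
      rw [inv_mul_le_iff₀ hC] at h9
      nlinarith [mul_le_mul_of_nonneg_left hP1 (mul_pos hC hC).le]
    exact mul_le_mul h5 (h6.trans h7) (by positivity) hS

lemma sqrt_iter {d : ℕ} {V : E d → ℝ} {m : ℝ} (hV : AssumptionA V m) (n : ℕ) :
    ∃ C > 0, ∀ R : ℝ, 1 ≤ R → ∀ ρ : E d × E d,
    ‖iteratedFDeriv ℝ n (fun ρ => √(R ^ 2 + ham V ρ)) ρ‖ ≤ C * √(R ^ 2 + ham V ρ) ∧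
    (1 ≤ n → ‖iteratedFDeriv ℝ n (fun ρ => √(R ^ 2 + ham V ρ)) ρ‖
      ≤ C * R⁻¹ * √(R ^ 2 + ham V ρ)) := by
  rcases Nat.eq_zero_or_pos n with rfl | hn
  · refine ⟨1, one_pos, fun R hR ρ => ⟨?_, by simp⟩⟩
    rw [norm_iteratedFDeriv_zero, Real.norm_of_nonneg (by positivity), one_mul]
  obtain ⟨B, hB, hBH⟩ := ham_iter hV n
  obtain ⟨C, hC, H⟩ := pow_iter (F := E d × E d) (1 / 2) n hn B hB
  refine ⟨C, hC, fun R hR ρ => ?_⟩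
  have hR0 : 0 < R := by linarith
  have hRi : R⁻¹ ≤ 1 := inv_le_one_of_one_le₀ hR
  have hge : ∀ ρ, R ^ 2 ≤ R ^ 2 + ham V ρ := fun ρ => by
    have : 0 ≤ ham V ρ := by
      have := hV.2.1 ρ.1
      unfold ham; positivity
    linarith
  have hp : ∀ ρ, 0 < R ^ 2 + ham V ρ := fun ρ => lt_of_lt_of_le (by positivity) (hge ρ)
  have hRs : R ≤ √(R ^ 2 + ham V ρ) := Real.le_sqrt_of_sq_le (hge ρ)
  have hinv : (√(R ^ 2 + ham V ρ))⁻¹ ≤ R⁻¹ := by gcongr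
  have hs0 : 0 < √(R ^ 2 + ham V ρ) := by linarith
  have h := H (fun ρ => R ^ 2 + ham V ρ) (contDiff_const.add (ham_contDiff hV)) hp ρ
    (√(R ^ 2 + ham V ρ))⁻¹ (by positivity) (hinv.trans hRi) (by
      intro i hi hin
      refine (hBH R hR i hi hin ρ).trans (le_of_eq ?_)
      have := Real.sq_sqrt (hp ρ).le
      field_simp
      linarith)
  simp only [← Real.sqrt_eq_rpow] at h
  have main : ‖iteratedFDeriv ℝ n (fun ρ => √(R ^ 2 + ham V ρ)) ρ‖
      ≤ C * R⁻¹ * √(R ^ 2 + ham V ρ) := h.trans (by gcongr)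
  refine ⟨main.trans ?_, fun _ => main⟩
  gcongr
  nlinarith

/-- Symbol bounds for `f_R`: `‖D^k f_R(ρ)‖ ≤ C_k R⁻¹ f_R(ρ)`, uniformly in `R ≥ 1`. -/
theorem stmt_12 (d : ℕ) (hd : 1 ≤ d) (V : E d → ℝ) (m : ℝ) (hV : AssumptionA V m)
    (ν : ℝ) (hν : 1 / 2 < ν) (k : ℕ) (hk : 1 ≤ k) :
    ∃ Ck > 0, ∀ R : ℝ, 1 ≤ R → ∀ ρ : E d × E d,
      ‖iteratedFDeriv ℝ k (fR V ν R) ρ‖ ≤ Ck * R⁻¹ * fR V ν R ρ := by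
  choose A hA HA using bracket_iter (d := d) ν
  choose B hB HB using sqrt_iter hV
  have hsum : 0 ≤ ∑ i ∈ Finset.range (k + 1), (k.choose i : ℝ) * (A i * B (k - i)) :=
    Finset.sum_nonneg fun i _ => by
      have := hA i
      have := hB (k - i)
      positivity
  refine ⟨1 + ∑ i ∈ Finset.range (k + 1), (k.choose i : ℝ) * (A i * B (k - i)), by linarith, ?_⟩
  intro R hR ρ
  have hR0 : 0 < R := by linarith
  have hp : ∀ ρ, 0 < R ^ 2 + ham V ρ := fun ρ => by
    have := hV.2.1 ρ.1
    unfold ham; positivity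
  have hg : ContDiff ℝ ∞ (fun ρ : E d × E d => (1 + ‖R⁻¹ • ρ.1‖ ^ 2) ^ (-ν)) := by
    refine ContDiff.rpow_const_of_ne ?_ fun y => by positivity
    exact contDiff_const.add ((contDiff_norm_sq ℝ).comp (contDiff_fst.const_smul _))
  have hh : ContDiff ℝ ∞ (fun ρ : E d × E d => √(R ^ 2 + ham V ρ)) :=
    (contDiff_const.add (ham_contDiff hV)).sqrt fun ρ => (hp ρ).ne'
  have key := norm_iteratedFDeriv_mul_le hg hh ρ (n := k) (by exact_mod_cast le_top)
  refine key.trans ?_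
  change _ ≤ _ * R⁻¹ * ((1 + ‖R⁻¹ • ρ.1‖ ^ 2) ^ (-ν) * √(R ^ 2 + ham V ρ))
  set g0 := (1 + ‖R⁻¹ • ρ.1‖ ^ 2) ^ (-ν) with hg0
  set h0 := √(R ^ 2 + ham V ρ) with hh0
  have hg0p : 0 ≤ g0 := by positivity
  have hh0p : 0 ≤ h0 := by positivity
  have hF : 0 ≤ R⁻¹ * (g0 * h0) := by positivity
  rw [mul_assoc, add_mul, Finset.sum_mul]
  refine le_add_of_nonneg_of_le (by linarith) (Finset.sum_le_sum fun i hi => ?_)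
  rw [mul_assoc, mul_assoc]
  refine mul_le_mul_of_nonneg_left ?_ (Nat.cast_nonneg _)
  have hAi := hA i
  have hBi := hB (k - i)
  rcases Nat.eq_zero_or_pos i with rfl | hi0
  · have h1 := (HA 0 R hR ρ).1
    have h2 := (HB (k - 0) R hR ρ).2 (by omega)
    refine (mul_le_mul h1 h2 (norm_nonneg _) (by positivity)).trans (le_of_eq ?_)
    ring
  · have h1 := (HA i R hR ρ).2 hi0
    have h2 := (HB (k - i) R hR ρ).1
    refine (mul_le_mul h1 h2 (norm_nonneg _) (by positivity)).trans (le_of_eq ?_)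
    ring

end
end

section
/- Let d ≥ 1, let V satisfy Assumption (A), and let φ be the Hamiltonian flow of p. Fix T > 0 and ν > 1/2, and for R ≥ 1 set f_R(x, ξ) = ⟨x/R⟩^(−2ν) (R² + p(x, ξ))^(1/2). Then for every integer k ≥ 1 there exists C_k > 0 such that for all R ≥ 1, all t ∈ [−T, T], and all ρ ∈ ℝ^{2d}: ‖D^k (f_R ∘ φ^t)(ρ)‖ ≤ C_k R^(−1) (f_R ∘ φ^t)(ρ). That is, ∇(f_R ∘ φ^t) ∈ S(R^(−1) f_R ∘ φ^t), uniformly with respect to R ≥ 1 and t ∈ [−T, T]. -/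
open Real MeasureTheory

noncomputable section

/-- The Hamiltonian flow of `p`: smooth in `(t,ρ)`, `φ⁰ = id`, and
`d/dt φᵗ(x,ξ) = (ξᵗ, -∇V(xᵗ))`. -/
def IsHamFlow {d : ℕ} (V : E d → ℝ) (φ : ℝ → E d × E d → E d × E d) : Prop :=
  ContDiff ℝ (⊤ : ℕ∞) (fun q : ℝ × (E d × E d) => φ q.1 q.2) ∧
  (∀ ρ, φ 0 ρ = ρ) ∧
  (∀ t ρ, HasDerivAt (fun s => φ s ρ) ((φ t ρ).2, -(gradient V (φ t ρ).1)) t)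

lemma aux_unif {P : ℕ → ℝ → Prop} (hmono : ∀ i a b, a ≤ b → P i a → P i b)
    (h : ∀ i, 1 ≤ i → ∃ C, P i C) (n : ℕ) : ∃ M, 1 ≤ M ∧ ∀ i, 1 ≤ i → i ≤ n → P i M := by
  induction n with
  | zero => exact ⟨1, le_rfl, fun i h1 h2 => by omega⟩
  | succ n ih =>
    obtain ⟨M, hM, hi⟩ := ih
    obtain ⟨C, hC⟩ := h (n + 1) (by omega)
    refine ⟨max M C, le_max_of_le_left hM, fun i h1 h2 => ?_⟩
    rcases Nat.lt_or_ge n i with h3 | h3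
    · obtain rfl : i = n + 1 := by omega
      exact hmono _ _ _ (le_max_right _ _) hC
    · exact hmono _ _ _ (le_max_left _ _) (hi i h1 h3)

lemma aux_natle (n : ℕ) : ((n : ℕ) : WithTop ℕ∞) ≤ ((⊤ : ℕ∞) : WithTop ℕ∞) := by
  exact_mod_cast le_top

lemma aux_comp {P Q W : Type*} [NormedAddCommGroup P] [NormedSpace ℝ P]
    [NormedAddCommGroup Q] [NormedSpace ℝ Q] [NormedAddCommGroup W] [NormedSpace ℝ W]
    {g : Q → W} {f : P → Q} (hg : ContDiff ℝ (⊤ : ℕ∞) g) (hf : ContDiff ℝ (⊤ : ℕ∞) f)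
    {n : ℕ} (hn : 1 ≤ n) (x : P) {C D : ℝ} (hC : 0 ≤ C)
    (h1 : ∀ i, 1 ≤ i → i ≤ n → ‖iteratedFDeriv ℝ i g (f x)‖ ≤ C)
    (h2 : ∀ i, 1 ≤ i → i ≤ n → ‖iteratedFDeriv ℝ i f x‖ ≤ D ^ i) :
    ‖iteratedFDeriv ℝ n (fun y => g (f y)) x‖ ≤ n.factorial * C * D ^ n := by
  have hsub : ∀ i, 1 ≤ i → ∀ {U : Type _} [NormedAddCommGroup U] [NormedSpace ℝ U] (u : U → W),
      ContDiff ℝ (⊤ : ℕ∞) u → iteratedFDeriv ℝ i (fun y => u y - g (f x)) = iteratedFDeriv ℝ i u := by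
    intro i hi U _ _ u hu
    have := iteratedFDeriv_sub (𝕜 := ℝ) (i := i) (f := u) (g := fun _ => g (f x))
      (hu.of_le (aux_natle i)) contDiff_const
    rw [iteratedFDeriv_const_of_ne (by omega), sub_zero] at this
    exact this
  have hsub' : ∀ i, 1 ≤ i → ∀ {U : Type _} [NormedAddCommGroup U] [NormedSpace ℝ U] (u : U → W),
      ContDiff ℝ (⊤ : ℕ∞) u → iteratedFDeriv ℝ i (fun y => u y - g (f x)) = iteratedFDeriv ℝ i u := by
    intro i hi U _ _ u hu
    have := iteratedFDeriv_sub (𝕜 := ℝ) (i := i) (f := u) (g := fun _ => g (f x))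
      (hu.of_le (aux_natle i)) contDiff_const
    rw [iteratedFDeriv_const_of_ne (by omega), sub_zero] at this
    exact this
  have := norm_iteratedFDeriv_comp_le (n := n) (g := fun y => g y - g (f x)) (f := f)
    (hg.sub contDiff_const) hf (aux_natle n) x (C := C) (D := D) ?_ h2
  · rw [← hsub' n hn (fun y => g (f y)) (hg.comp hf)]
    exact this
  · intro i hi
    rcases Nat.eq_zero_or_pos i with rfl | h
    · simpa using hC
    · rw [hsub i h g hg]
      exact h1 i h hi

lemma aux_pow {P : Type*} [NormedAddCommGroup P] [NormedSpace ℝ P] (a : ℝ) (n : ℕ) (hn : 1 ≤ n)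
    (M : ℝ) (hM : 1 ≤ M) : ∃ K, 0 ≤ K ∧ ∀ g : P → ℝ, ContDiff ℝ (⊤ : ℕ∞) g → (∀ y, 0 < g y) →
      ∀ ε, 0 < ε → ε ≤ 1 → ∀ x, (∀ i, 1 ≤ i → i ≤ n → ‖iteratedFDeriv ℝ i g x‖ ≤ M * ε * g x) →
      ‖iteratedFDeriv ℝ n (fun y => g y ^ a) x‖ ≤ K * ε * g x ^ a := by
  set u : ℝ → ℝ := fun y => y ^ a with hu
  set c : ℕ → ℝ := fun i => ‖iteratedFDerivWithin ℝ i u (Set.Ioi 0) 1‖ with hc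
  set C : ℝ := ∑ i ∈ Finset.range (n + 1), c i with hC
  have hC0 : 0 ≤ C := Finset.sum_nonneg fun i _ => norm_nonneg _
  refine ⟨n.factorial * C * M ^ n, by positivity, ?_⟩
  intro g hg hpos ε hε hε1 x hx
  have hgx := hpos x
  have hucd : ContDiffOn ℝ (⊤ : ℕ∞) u (Set.Ioi 0) := fun y hy =>
    (Real.contDiffAt_rpow_const_of_ne (ne_of_gt hy)).contDiffWithinAt
  set f : P → ℝ := (g x)⁻¹ • g with hf
  have hfcd : ContDiff ℝ (⊤ : ℕ∞) f := by
    have := hg.const_smul (g x)⁻¹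
    exact this
  have hfx : f x = 1 := by simp [hf, hgx.ne']
  set D : ℝ := M * ε ^ ((1:ℝ) / n) with hD
  have hn0 : (0:ℝ) < n := by exact_mod_cast hn
  have key := norm_iteratedFDerivWithin_comp_le (n := n) (g := u) (f := f) (s := Set.univ)
    (t := Set.Ioi 0) (x := x) (N := ((⊤ : ℕ∞) : WithTop ℕ∞)) hucd hfcd.contDiffOn (aux_natle n)
    (uniqueDiffOn_Ioi 0) uniqueDiffOn_univ
    (fun y _ => by simp only [hf, Pi.smul_apply, smul_eq_mul, Set.mem_Ioi]; exact mul_pos (inv_pos.2 hgx) (hpos y))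
    (Set.mem_univ x) (C := C) (D := D) ?_ ?_
  · rw [iteratedFDerivWithin_univ] at key
    have e1 : (fun y => g y ^ a) = (g x ^ a) • (u ∘ f) := by
      ext y
      simp only [hu, hf, Function.comp, Pi.smul_apply, smul_eq_mul]
      rw [Real.mul_rpow (inv_pos.2 hgx).le (hpos y).le, Real.inv_rpow hgx.le]
      field_simp
    have hcomp : ContDiff ℝ (⊤ : ℕ∞) (u ∘ f) := by
      refine contDiff_iff_contDiffAt.2 fun y => ?_
      refine ContDiffAt.comp y (Real.contDiffAt_rpow_const_of_ne ?_) hfcd.contDiffAt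
      simp only [hf, Pi.smul_apply, smul_eq_mul]
      exact (mul_pos (inv_pos.2 hgx) (hpos y)).ne'
    rw [e1, iteratedFDeriv_const_smul_apply (hcomp.of_le (aux_natle n)).contDiffAt, norm_smul,
      Real.norm_of_nonneg (Real.rpow_nonneg hgx.le a)]
    have hDn : D ^ n = M ^ n * ε := by
      rw [hD, mul_pow, ← Real.rpow_natCast (ε ^ _), ← Real.rpow_mul hε.le]
      simp [hn0.ne']
    rw [hDn] at key
    calc g x ^ a * _ ≤ g x ^ a * (n.factorial * C * (M ^ n * ε)) := by
          gcongr
      _ = _ := by ring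
  · intro i hi
    rw [hfx]
    exact Finset.single_le_sum (f := c) (fun i _ => norm_nonneg _) (Finset.mem_range.2 (by omega))
  · intro i h1 hi
    rw [iteratedFDerivWithin_univ, hf,
      iteratedFDeriv_const_smul_apply (hg.of_le (aux_natle i)).contDiffAt, norm_smul, norm_inv,
      Real.norm_of_nonneg hgx.le]
    have h3 := hx i h1 hi
    have h4 : ε ≤ (ε ^ ((1:ℝ) / n)) ^ i := by
      rw [← Real.rpow_natCast (ε ^ _), ← Real.rpow_mul hε.le]
      conv_lhs => rw [← Real.rpow_one ε]
      apply Real.rpow_le_rpow_of_exponent_ge hε hε1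
      rw [one_div, inv_mul_le_iff₀ hn0, mul_one]
      exact_mod_cast hi
    have h5 : M ≤ M ^ i := le_self_pow₀ hM (by omega)
    calc (g x)⁻¹ * _ ≤ (g x)⁻¹ * (M * ε * g x) := by gcongr
      _ = M * ε := by field_simp
      _ ≤ M ^ i * (ε ^ ((1:ℝ) / n)) ^ i := by gcongr
      _ = _ := by rw [hD, mul_pow]

lemma aux_mul {P : Type*} [NormedAddCommGroup P] [NormedSpace ℝ P] (n : ℕ) (hn : 1 ≤ n)
    (M : ℝ) (hM : 1 ≤ M) (f g : P → ℝ) (hf : ContDiff ℝ (⊤ : ℕ∞) f) (hg : ContDiff ℝ (⊤ : ℕ∞) g)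
    (fpos : ∀ y, 0 < f y) (gpos : ∀ y, 0 < g y)
    (ε : ℝ) (hε : 0 < ε) (hε1 : ε ≤ 1) (x : P)
    (hfx : ∀ i, 1 ≤ i → i ≤ n → ‖iteratedFDeriv ℝ i f x‖ ≤ M * ε * f x)
    (hgx : ∀ i, 1 ≤ i → i ≤ n → ‖iteratedFDeriv ℝ i g x‖ ≤ M * ε * g x) :
    ‖iteratedFDeriv ℝ n (fun y => f y * g y) x‖ ≤ (2 ^ n * M ^ 2) * ε * (f x * g x) := by
  have weak : ∀ u : P → ℝ, (∀ y, 0 < u y) →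
      (∀ i, 1 ≤ i → i ≤ n → ‖iteratedFDeriv ℝ i u x‖ ≤ M * ε * u x) →
      ∀ i ≤ n, ‖iteratedFDeriv ℝ i u x‖ ≤ M * u x := by
    intro u upos hu i hi
    have := upos x
    rcases Nat.eq_zero_or_pos i with rfl | h
    · rw [norm_iteratedFDeriv_zero, Real.norm_of_nonneg this.le]
      nlinarith
    · refine (hu i h hi).trans ?_
      have : M * ε ≤ M := by nlinarith
      gcongr
  refine (norm_iteratedFDeriv_mul_le hf hg x (aux_natle n)).trans ?_
  have h0 := fpos x
  have h0' := gpos x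
  calc _ ≤ ∑ i ∈ Finset.range (n + 1), (n.choose i : ℝ) * (M ^ 2 * ε * (f x * g x)) := by
        refine Finset.sum_le_sum fun i hi => ?_
        have hi : i ≤ n := by simpa [Nat.lt_succ_iff] using hi
        rw [mul_assoc]
        refine mul_le_mul_of_nonneg_left ?_ (by positivity)
        rcases Nat.eq_zero_or_pos i with rfl | h
        · calc _ ≤ (M * f x) * (M * ε * g x) :=
                mul_le_mul (weak f fpos hfx 0 hi) (hgx _ (by omega) (by omega)) (norm_nonneg _) (by positivity)
            _ = _ := by ring
        · calc _ ≤ (M * ε * f x) * (M * g x) :=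
                mul_le_mul (hfx i h hi) (weak g gpos hgx _ (by omega)) (norm_nonneg _) (by positivity)
            _ = _ := by ring
    _ = _ := by
        rw [← Finset.sum_mul]
        have : ∑ i ∈ Finset.range (n + 1), (n.choose i : ℝ) = 2 ^ n := by
          exact_mod_cast Nat.sum_range_choose n
        rw [this]; ring

lemma aux_gron {W : Type*} [NormedAddCommGroup W] [NormedSpace ℝ W] (A A' : ℝ → W)
    (hA : ∀ t, HasDerivAt A (A' t) t) (T K δ ε : ℝ) (hK : 0 ≤ K) (hε : 0 ≤ ε)
    (h0 : ‖A 0‖ ≤ δ) (hb : ∀ t ∈ Set.Icc (-T) T, ‖A' t‖ ≤ K * ‖A t‖ + ε) :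
    ∀ t ∈ Set.Icc (-T) T, ‖A t‖ ≤ gronwallBound δ K ε T := by
  have hδ : 0 ≤ δ := (norm_nonneg _).trans h0
  have main : ∀ B B' : ℝ → W, (∀ t, HasDerivAt B (B' t) t) → ‖B 0‖ ≤ δ →
      (∀ t ∈ Set.Icc (-T) T, ‖B' t‖ ≤ K * ‖B t‖ + ε) → ∀ t ∈ Set.Icc 0 T,
      ‖B t‖ ≤ gronwallBound δ K ε T := by
    intro B B' hB h0 hb t ht
    have := norm_le_gronwallBound_of_norm_deriv_right_le (f := B) (f' := B') (a := 0) (b := T)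
      (fun x _ => (hB x).continuousAt.continuousWithinAt) (fun x _ => (hB x).hasDerivWithinAt) h0
      (fun x hx => hb x ⟨by linarith [hx.1, hx.2], hx.2.le⟩) t ht
    refine this.trans (gronwallBound_mono hδ hε hK ?_)
    simpa using ht.2
  intro t ht
  rcases le_total 0 t with h | h
  · exact main A A' hA h0 hb t ⟨h, ht.2⟩
  · have := main (fun s => A (-s)) (fun s => -A' (-s)) (fun s => by
      have := (hA (-s)).scomp s (hasDerivAt_neg s)
      rw [neg_one_smul] at this
      exact this) (by simpa using h0)
      (fun s hs => by rw [norm_neg]; exact hb (-s) ⟨by linarith [hs.2], by linarith [hs.1]⟩) (-t)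
      ⟨by linarith, by linarith [ht.1]⟩
    simpa using this

universe u
lemma aux_swap {P : Type u} [NormedAddCommGroup P] [NormedSpace ℝ P] (k : ℕ) :
    ∀ {G : Type u} [NormedAddCommGroup G] [NormedSpace ℝ G] (F F' : ℝ → P → G),
    ContDiff ℝ (⊤ : ℕ∞) (fun q : ℝ × P => F q.1 q.2) →
    (∀ t ρ, HasDerivAt (fun s => F s ρ) (F' t ρ) t) → ∀ t ρ,
    HasDerivAt (fun s => iteratedFDeriv ℝ k (F s) ρ) (iteratedFDeriv ℝ k (F' t) ρ) t := by
  induction k with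
  | zero =>
    intro G _ _ F F' hF hd t ρ
    have := ((continuousMultilinearCurryFin0 ℝ P G).symm.toContinuousLinearEquiv.toContinuousLinearMap.hasFDerivAt
      (x := F t ρ)).comp_hasDerivAt t (hd t ρ)
    exact this
  | succ k ih =>
    intro G _ _ F F' hF hd t ρ
    set H : ℝ × P → G := fun q => F q.1 q.2 with hH
    have hHd : Differentiable ℝ H := hF.differentiable (by simp)
    have hF'eq : ∀ t ρ, F' t ρ = fderiv ℝ H (t, ρ) (1, 0) := by
      intro t ρ
      have h1 : HasDerivAt (fun s : ℝ => (s, ρ)) ((1 : ℝ), (0 : P)) t :=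
        (hasDerivAt_id t).prodMk (hasDerivAt_const t ρ)
      have h2 := (hHd (t, ρ)).hasFDerivAt.comp_hasDerivAt t h1
      exact (hd t ρ).unique h2
    have hDx : ∀ t ρ, fderiv ℝ (F t) ρ = (fderiv ℝ H (t, ρ)).comp (ContinuousLinearMap.inr ℝ ℝ P) := by
      intro t ρ
      exact ((hHd (t, ρ)).hasFDerivAt.comp ρ (hasFDerivAt_prodMk_right t ρ)).fderiv
    have hDH : ContDiff ℝ (⊤ : ℕ∞) (fderiv ℝ H) := hF.fderiv_right (by simp)
    have hDHd : Differentiable ℝ (fderiv ℝ H) := hDH.differentiable (by simp)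
    have step := ih (fun s σ => fderiv ℝ (F s) σ) (fun s σ => fderiv ℝ (F' s) σ) ?_ ?_ t ρ
    · have := ((continuousMultilinearCurryRightEquiv' ℝ k P G).symm.toContinuousLinearEquiv.toContinuousLinearMap.hasFDerivAt
        (x := iteratedFDeriv ℝ k (fun σ => fderiv ℝ (F t) σ) ρ)).comp_hasDerivAt t step
      simp only [iteratedFDeriv_succ_eq_comp_right]
      exact this
    · have : (fun q : ℝ × P => fderiv ℝ (F q.1) q.2) =
          fun q => (fderiv ℝ H q).comp (ContinuousLinearMap.inr ℝ ℝ P) := by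
        ext1 q; exact hDx q.1 q.2
      rw [this]
      exact hDH.clm_comp contDiff_const
    · intro t ρ
      have h1 : HasDerivAt (fun s : ℝ => (s, ρ)) ((1 : ℝ), (0 : P)) t :=
        (hasDerivAt_id t).prodMk (hasDerivAt_const t ρ)
      have h2 := (hDHd (t, ρ)).hasFDerivAt.comp_hasDerivAt t h1
      have h3 := h2.clm_comp (hasDerivAt_const t (ContinuousLinearMap.inr ℝ ℝ P))
      have e : (fun s => fderiv ℝ (F s) ρ) = fun s => (fderiv ℝ H (s, ρ)).comp (ContinuousLinearMap.inr ℝ ℝ P) := by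
        ext1 s; exact hDx s ρ
      rw [e]
      suffices hs : fderiv ℝ (F' t) ρ = ((fderiv ℝ (fderiv ℝ H) (t, ρ)) (1, 0)).comp (ContinuousLinearMap.inr ℝ ℝ P) +
          (fderiv ℝ H (t, ρ)).comp 0 by
        rw [hs]; exact h3
      have e2 : F' t = fun ρ => fderiv ℝ H (t, ρ) (1, 0) := by ext1 σ; exact hF'eq t σ
      have h4 : HasFDerivAt (fun σ => fderiv ℝ H (t, σ)) _ ρ :=
        (hDHd (t, ρ)).hasFDerivAt.comp ρ (hasFDerivAt_prodMk_right t ρ)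
      have h5 := h4.clm_apply (hasFDerivAt_const ((1:ℝ), (0:P)) ρ)
      rw [e2, h5.fderiv]
      have symm : IsSymmSndFDerivAt ℝ H (t, ρ) := hF.contDiffAt.isSymmSndFDerivAt (by
        rw [minSmoothness_of_isRCLikeNormedField]; exact aux_natle 2)
      ext v
      simpa using symm (0, v) (1, 0)

lemma aux_flow {P : Type u} [NormedAddCommGroup P] [NormedSpace ℝ P] (X : P → P)
    (hX : ContDiff ℝ (⊤ : ℕ∞) X) (hXb : ∀ i, 1 ≤ i → ∃ C, ∀ p, ‖iteratedFDeriv ℝ i X p‖ ≤ C)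
    (φ : ℝ → P → P) (hφ : ContDiff ℝ (⊤ : ℕ∞) (fun q : ℝ × P => φ q.1 q.2))
    (h0 : ∀ ρ, φ 0 ρ = ρ) (hd : ∀ t ρ, HasDerivAt (fun s => φ s ρ) (X (φ t ρ)) t) (T : ℝ) (k : ℕ) :
    1 ≤ k → ∃ C, ∀ t ∈ Set.Icc (-T) T, ∀ ρ, ‖iteratedFDeriv ℝ k (φ t) ρ‖ ≤ C := by
  have hφt : ∀ t, ContDiff ℝ (⊤ : ℕ∞) (φ t) := fun t =>
    hφ.comp (contDiff_const.prodMk contDiff_id)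
  induction k using Nat.strong_induction_on with
  | _ k ih =>
  intro hk
  obtain ⟨B, hB1, hB⟩ := aux_unif (P := fun i C => i < k → ∀ t ∈ Set.Icc (-T) T, ∀ ρ,
      ‖iteratedFDeriv ℝ i (φ t) ρ‖ ≤ C)
    (fun i a b hab h hi t ht ρ => (h hi t ht ρ).trans hab)
    (fun i hi => by
      by_cases h : i < k
      · obtain ⟨C, hC⟩ := ih i h hi
        exact ⟨C, fun _ => hC⟩
      · exact ⟨0, fun h' => absurd h' h⟩) k
  obtain ⟨M, hM1, hM⟩ := aux_unif (P := fun i C => ∀ p, ‖iteratedFDeriv ℝ i X p‖ ≤ C)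
    (fun i a b hab h p => (h p).trans hab) hXb k
  have hstart : ∃ δ, ∀ ρ : P, ‖iteratedFDeriv ℝ k (φ 0) ρ‖ ≤ δ := by
    have e : φ 0 = fun x => x := funext h0
    rw [e]
    obtain ⟨j, rfl⟩ : ∃ j, k = j + 1 := ⟨k - 1, by omega⟩
    rcases Nat.eq_zero_or_pos j with rfl | hj
    · refine ⟨1, fun ρ => ?_⟩
      rw [zero_add, norm_iteratedFDeriv_one, fderiv_fun_id]
      exact ContinuousLinearMap.norm_id_le
    · refine ⟨0, fun ρ => ?_⟩
      rw [← norm_iteratedFDeriv_fderiv]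
      have : fderiv ℝ (fun x : P => x) = fun _ => ContinuousLinearMap.id ℝ P := by
        ext1 x; exact fderiv_fun_id
      rw [this, iteratedFDeriv_const_of_ne (by omega)]
      simp
  obtain ⟨δ, hδ⟩ := hstart
  set K : ℝ := k.factorial * M with hKdef
  refine ⟨gronwallBound δ K (K * B ^ k) T, fun t ht ρ => ?_⟩
  refine aux_gron (fun s => iteratedFDeriv ℝ k (φ s) ρ)
    (fun s => iteratedFDeriv ℝ k (fun σ => X (φ s σ)) ρ)
    (fun s => aux_swap k φ (fun s σ => X (φ s σ)) hφ hd s ρ) T K δ (K * B ^ k) (by positivity)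
    (by positivity) (hδ ρ) ?_ t ht
  intro s hs
  set a : ℝ := ‖iteratedFDeriv ℝ k (φ s) ρ‖ with ha
  have ha0 : 0 ≤ a := norm_nonneg _
  set r : ℝ := a ^ ((1:ℝ) / k) with hr
  have hr0 : 0 ≤ r := Real.rpow_nonneg ha0 _
  have hrk : r ^ k = a := by
    rw [hr, ← Real.rpow_natCast, ← Real.rpow_mul ha0]
    have : (k:ℝ) ≠ 0 := by exact_mod_cast (by omega : k ≠ 0)
    simp [this]
  have hb := aux_comp hX (hφt s) hk ρ (C := M) (D := max B r) (by linarith)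
    (fun i h1 h2 => hM i h1 h2 _) (fun i h1 h2 => by
      rcases lt_or_eq_of_le h2 with h | h
      · refine (hB i h1 h2 h s hs ρ).trans ?_
        have h7 : B ≤ B ^ i := le_self_pow₀ hB1 (by omega)
        exact h7.trans (pow_le_pow_left₀ (by linarith) (le_max_left _ _) i)
      · subst h
        rw [← ha, ← hrk]
        exact pow_le_pow_left₀ hr0 (le_max_right _ _) _)
  refine hb.trans ?_
  have : (max B r) ^ k ≤ a + B ^ k := by
    rcases le_total B r with h | h
    · rw [max_eq_right h, hrk]
      have : 0 ≤ B ^ k := by positivity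
      linarith
    · rw [max_eq_left h]; linarith
  calc K * (max B r) ^ k ≤ K * (a + B ^ k) := by gcongr
    _ = _ := by ring

lemma aux_right {P Q W : Type*} [NormedAddCommGroup P] [NormedSpace ℝ P]
    [NormedAddCommGroup Q] [NormedSpace ℝ Q] [NormedAddCommGroup W] [NormedSpace ℝ W]
    (L : P →L[ℝ] Q) (hL : ‖L‖ ≤ 1) {g : Q → W} (hg : ContDiff ℝ (⊤ : ℕ∞) g) (i : ℕ) (x : P) :
    ‖iteratedFDeriv ℝ i (fun y => g (L y)) x‖ ≤ ‖iteratedFDeriv ℝ i g (L x)‖ := by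
  have := L.iteratedFDeriv_comp_right hg x (aux_natle i)
  change ‖iteratedFDeriv ℝ i (g ∘ L) x‖ ≤ _
  rw [this]
  refine (ContinuousMultilinearMap.norm_compContinuousLinearMap_le _ _).trans ?_
  refine mul_le_of_le_one_right (norm_nonneg _) ?_
  exact Finset.prod_le_one (fun _ _ => norm_nonneg _) (fun _ _ => hL)

lemma aux_normsq {H : Type*} [NormedAddCommGroup H] [InnerProductSpace ℝ H] (k : ℕ) (hk : 1 ≤ k)
    (x : H) : ‖iteratedFDeriv ℝ k (fun y : H => ‖y‖ ^ 2) x‖ ≤ 2 * (1 + ‖x‖) := by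
  obtain ⟨j, rfl⟩ : ∃ j, k = j + 1 := ⟨k - 1, by omega⟩
  have hx := norm_nonneg x
  have h2 : ‖(2 : ℕ) • (innerSL ℝ : H →L[ℝ] H →L[ℝ] ℝ)‖ ≤ 2 := by
    refine ContinuousLinearMap.opNorm_le_bound _ (by norm_num) fun y => ?_
    change ‖(2 : ℕ) • (innerSL ℝ y)‖ ≤ _
    refine (norm_nsmul_le).trans ?_
    simp
  have e : (fderiv ℝ fun y : H => ‖y‖ ^ 2) = ((2 : ℕ) • (innerSL ℝ : H →L[ℝ] H →L[ℝ] ℝ) : H →L[ℝ] H →L[ℝ] ℝ) := by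
    rw [fderiv_norm_sq]; rfl
  rw [← norm_iteratedFDeriv_fderiv, e]
  generalize (2 : ℕ) • (innerSL ℝ : H →L[ℝ] H →L[ℝ] ℝ) = L at h2
  rcases Nat.eq_zero_or_pos j with rfl | hj
  · rw [norm_iteratedFDeriv_zero]
    refine (L.le_opNorm x).trans ?_
    nlinarith
  · obtain ⟨l, rfl⟩ : ∃ l, j = l + 1 := ⟨j - 1, by omega⟩
    have e3 : fderiv ℝ L = fun _ => L := by ext1 y; exact L.fderiv
    rw [← norm_iteratedFDeriv_fderiv, e3]
    rcases Nat.eq_zero_or_pos l with rfl | hl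
    · rw [norm_iteratedFDeriv_zero]; linarith
    · rw [iteratedFDeriv_const_of_ne (by omega)]
      simp; positivity

lemma aux_field {d : ℕ} {V : E d → ℝ} {m : ℝ} (hV : AssumptionA V m) :
    ContDiff ℝ (⊤ : ℕ∞) (fun ρ : E d × E d => (ρ.2, -(gradient V ρ.1))) ∧
    ∀ i, 1 ≤ i → ∃ C, ∀ p : E d × E d,
      ‖iteratedFDeriv ℝ i (fun ρ : E d × E d => (ρ.2, -(gradient V ρ.1))) p‖ ≤ C := by
  obtain ⟨hVs, hV0, hm0, hm1, -, hVd⟩ := hV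
  set L : (E d →L[ℝ] ℝ) ≃ₗᵢ[ℝ] E d := (InnerProductSpace.toDual ℝ (E d)).symm with hL
  have hDV : ContDiff ℝ (⊤ : ℕ∞) (fderiv ℝ V) := hVs.fderiv_right (by simp)
  have hgr : gradient V = L ∘ fderiv ℝ V := rfl
  have hgs : ContDiff ℝ (⊤ : ℕ∞) (gradient V) := by
    rw [hgr]; exact L.contDiff.comp hDV
  have hng : ContDiff ℝ (⊤ : ℕ∞) (fun y => -(gradient V y)) := hgs.neg
  have hA : ContDiff ℝ (⊤ : ℕ∞) (fun ρ : E d × E d => -(gradient V ρ.1)) := hng.comp contDiff_fst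
  refine ⟨contDiff_snd.prodMk hA, fun i hi => ?_⟩
  obtain ⟨C, hC0, hC⟩ := hVd (i + 1)
  refine ⟨max 1 C, fun p => ?_⟩
  rw [iteratedFDeriv_prodMk (n := ((⊤ : ℕ∞) : WithTop ℕ∞)) contDiff_snd.contDiffAt hA.contDiffAt (aux_natle i),
    ContinuousMultilinearMap.opNorm_prod]
  refine max_le_max ?_ ?_
  · refine (aux_right (ContinuousLinearMap.snd ℝ (E d) (E d)) (ContinuousLinearMap.norm_snd_le ..)
      (g := fun y => y) contDiff_id i p).trans ?_
    obtain ⟨j, rfl⟩ : ∃ j, i = j + 1 := ⟨i - 1, by omega⟩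
    have : fderiv ℝ (fun x : E d => x) = fun _ => ContinuousLinearMap.id ℝ (E d) := by
      ext1 x; exact fderiv_fun_id
    rw [← norm_iteratedFDeriv_fderiv, this]
    rcases Nat.eq_zero_or_pos j with rfl | hj
    · rw [norm_iteratedFDeriv_zero]
      exact ContinuousLinearMap.norm_id_le
    · rw [iteratedFDeriv_const_of_ne (by omega)]
      simp
  · refine (aux_right (ContinuousLinearMap.fst ℝ (E d) (E d)) (ContinuousLinearMap.norm_fst_le ..)
      (g := fun y => -(gradient V y)) hng i p).trans ?_
    have : (fun y => -(gradient V y)) = (L.trans (LinearIsometryEquiv.neg ℝ)) ∘ fderiv ℝ V := rfl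
    rw [this, LinearIsometryEquiv.norm_iteratedFDeriv_comp_left, norm_iteratedFDeriv_fderiv]
    refine (hC _).trans (mul_le_of_le_one_right hC0.le ?_)
    apply Real.rpow_le_one_of_one_le_of_nonpos
    · have := sq_nonneg ‖ContinuousLinearMap.fst ℝ (E d) (E d) p‖
      linarith
    · have : (1:ℝ) ≤ i := by exact_mod_cast hi
      push_cast; linarith

lemma aux_ham {d : ℕ} {V : E d → ℝ} {m : ℝ} (hV : AssumptionA V m) (i : ℕ) (hi : 1 ≤ i) :
    ∃ C, ∀ R : ℝ, 1 ≤ R → ∀ p : E d × E d,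
      ‖iteratedFDeriv ℝ i (fun ρ : E d × E d => R ^ 2 + ham V ρ) p‖ ≤ C * R⁻¹ * (R ^ 2 + ham V p) := by
  obtain ⟨hVs, hV0, hm0, hm1, ⟨C₀, hC₀, hVb⟩, hVd⟩ := hV
  obtain ⟨C, hC0, hC⟩ := hVd i
  refine ⟨4 + C * Real.sqrt (C₀ * (1 + C₀)), fun R hR p => ?_⟩
  set g := R ^ 2 + ham V p with hg
  have hi' : (1:ℝ) ≤ i := by exact_mod_cast hi
  have hham : (1 / 2) * ‖p.2‖ ^ 2 + V p.1 = ham V p := rfl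
  have hVp := hV0 p.1
  have hsq := sq_nonneg ‖p.2‖
  have hR2 : 1 ≤ R ^ 2 := by nlinarith
  have hg1 : R ^ 2 ≤ g := by linarith
  have hgR : R ≤ Real.sqrt g := Real.le_sqrt_of_sq_le hg1
  have hss : Real.sqrt g * Real.sqrt g = g := Real.mul_self_sqrt (by linarith)
  have hsg : Real.sqrt g ≤ R⁻¹ * g := by
    rw [le_inv_mul_iff₀ (by linarith)]
    nlinarith [Real.sqrt_nonneg g]
  have hxi : ‖p.2‖ ≤ 2 * Real.sqrt g := by
    apply abs_le_of_sq_le_sq' _ (by positivity) |>.2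
    rw [mul_pow, Real.sq_sqrt (by linarith)]
    linarith
  -- the kinetic part
  have hk1 : ContDiff ℝ (⊤ : ℕ∞) (fun y : E d => ‖y‖ ^ 2) := contDiff_norm_sq ℝ
  have hk2 : ContDiff ℝ (⊤ : ℕ∞) (fun ρ : E d × E d => ‖ρ.2‖ ^ 2) := hk1.comp contDiff_snd
  have hk3 : ContDiff ℝ (⊤ : ℕ∞) ((1 / 2 : ℝ) • fun ρ : E d × E d => ‖ρ.2‖ ^ 2) := by
    have := hk2.const_smul (1 / 2 : ℝ)
    exact this
  have hv : ContDiff ℝ (⊤ : ℕ∞) (fun ρ : E d × E d => V ρ.1) := hVs.comp contDiff_fst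
  have e : (fun ρ : E d × E d => R ^ 2 + ham V ρ) =
      (fun _ => R ^ 2) + (((1 / 2 : ℝ) • fun ρ : E d × E d => ‖ρ.2‖ ^ 2) + fun ρ => V ρ.1) := by
    ext ρ; simp [ham]
  have hle := aux_natle i
  have hkv : ContDiff ℝ (⊤ : ℕ∞) (((1 / 2 : ℝ) • fun ρ : E d × E d => ‖ρ.2‖ ^ 2) + fun ρ => V ρ.1) :=
    hk3.add hv
  rw [e, iteratedFDeriv_add_apply contDiff_const.contDiffAt (hkv.of_le hle).contDiffAt,
    iteratedFDeriv_const_of_ne (by omega), iteratedFDeriv_add_apply (hk3.of_le hle).contDiffAt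
    (hv.of_le hle).contDiffAt, iteratedFDeriv_const_smul_apply (hk2.of_le hle).contDiffAt]
  have b1 : ‖iteratedFDeriv ℝ i (fun ρ : E d × E d => ‖ρ.2‖ ^ 2) p‖ ≤ 2 * (1 + ‖p.2‖) :=
    (aux_right (ContinuousLinearMap.snd ℝ (E d) (E d)) (ContinuousLinearMap.norm_snd_le ..)
      hk1 i p).trans (aux_normsq i hi _)
  have b2 : ‖iteratedFDeriv ℝ i (fun ρ : E d × E d => V ρ.1) p‖ ≤
      C * (1 + ‖p.1‖ ^ 2) ^ (m - (i : ℝ) / 2) :=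
    (aux_right (ContinuousLinearMap.fst ℝ (E d) (E d)) (ContinuousLinearMap.norm_fst_le ..)
      hVs i p).trans (hC _)
  have hJ : 1 ≤ 1 + ‖p.1‖ ^ 2 := by nlinarith [sq_nonneg ‖p.1‖]
  have b3 : (1 + ‖p.1‖ ^ 2) ^ (m - (i : ℝ) / 2) ≤ Real.sqrt (C₀ * (1 + C₀)) * Real.sqrt g := by
    calc _ ≤ (1 + ‖p.1‖ ^ 2) ^ (m * (1 / 2)) :=
          Real.rpow_le_rpow_of_exponent_le hJ (by linarith)
      _ = Real.sqrt ((1 + ‖p.1‖ ^ 2) ^ m) := by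
          rw [Real.rpow_mul (by linarith), Real.sqrt_eq_rpow]
      _ ≤ Real.sqrt (C₀ * (1 + C₀) * g) := by
          apply Real.sqrt_le_sqrt
          have := (hVb p.1).1
          have h5 : (1 + ‖p.1‖ ^ 2) ^ m ≤ C₀ * (V p.1 + C₀) := by
            rw [← inv_mul_le_iff₀ hC₀]; linarith
          refine h5.trans ?_
          rw [mul_assoc]
          gcongr
          nlinarith
      _ = _ := Real.sqrt_mul (by positivity) _
  rw [Pi.zero_apply, zero_add]
  refine (norm_add_le _ _).trans ?_
  rw [norm_smul]
  have : ‖(1 / 2 : ℝ)‖ = 1 / 2 := by norm_num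
  rw [this]
  have b4 : C * (1 + ‖p.1‖ ^ 2) ^ (m - (i : ℝ) / 2) ≤ C * (Real.sqrt (C₀ * (1 + C₀)) * Real.sqrt g) := by
    gcongr
  calc _ ≤ (4 + C * Real.sqrt (C₀ * (1 + C₀))) * Real.sqrt g := by nlinarith
    _ ≤ (4 + C * Real.sqrt (C₀ * (1 + C₀))) * (R⁻¹ * g) := by gcongr
    _ = _ := by ring

lemma aux_wt {d : ℕ} (i : ℕ) (hi : 1 ≤ i) (R : ℝ) (hR : 1 ≤ R) (p : E d × E d) :
      ‖iteratedFDeriv ℝ i (fun ρ : E d × E d => 1 + ‖R⁻¹ • ρ.1‖ ^ 2) p‖ ≤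
        4 * R⁻¹ * (1 + ‖R⁻¹ • p.1‖ ^ 2) := by
  have hk1 : ContDiff ℝ (⊤ : ℕ∞) (fun y : E d => ‖y‖ ^ 2) := contDiff_norm_sq ℝ
  have hk2 : ContDiff ℝ (⊤ : ℕ∞) (fun ρ : E d × E d => ‖ρ.1‖ ^ 2) := hk1.comp contDiff_fst
  have hk3 : ContDiff ℝ (⊤ : ℕ∞) (((R⁻¹) ^ 2 : ℝ) • fun ρ : E d × E d => ‖ρ.1‖ ^ 2) := by
    have := hk2.const_smul ((R⁻¹) ^ 2 : ℝ)
    exact this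
  have hR0 : 0 < R := by linarith
  have e : (fun ρ : E d × E d => 1 + ‖R⁻¹ • ρ.1‖ ^ 2) =
      (fun _ => 1) + (((R⁻¹) ^ 2 : ℝ) • fun ρ : E d × E d => ‖ρ.1‖ ^ 2) := by
    ext ρ; simp [norm_smul, mul_pow]
  have hle := aux_natle i
  rw [e, iteratedFDeriv_add_apply contDiff_const.contDiffAt (hk3.of_le hle).contDiffAt,
    iteratedFDeriv_const_of_ne (by omega), iteratedFDeriv_const_smul_apply (hk2.of_le hle).contDiffAt]
  have b1 : ‖iteratedFDeriv ℝ i (fun ρ : E d × E d => ‖ρ.1‖ ^ 2) p‖ ≤ 2 * (1 + ‖p.1‖) :=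
    (aux_right (ContinuousLinearMap.fst ℝ (E d) (E d)) (ContinuousLinearMap.norm_fst_le ..)
      hk1 i p).trans (aux_normsq i hi _)
  rw [Pi.zero_apply, zero_add, norm_smul, Real.norm_of_nonneg (by positivity), norm_smul,
    Real.norm_of_nonneg (by positivity)]
  have hr0 : 0 < R⁻¹ := by positivity
  have hr1 : R⁻¹ ≤ 1 := inv_le_one_of_one_le₀ hR
  generalize R⁻¹ = r at *
  calc r ^ 2 * _ ≤ r ^ 2 * (2 * (1 + ‖p.1‖)) := by gcongr
    _ = r * (2 * r + 2 * (r * ‖p.1‖)) := by ring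
    _ ≤ r * (4 * (1 + (r * ‖p.1‖) ^ 2)) := by
        gcongr
        nlinarith [sq_nonneg (r * ‖p.1‖ - 1)]
    _ = _ := by ring

/-- Symbol bounds for `f_R ∘ φᵗ`: `‖D^k (f_R ∘ φᵗ)(ρ)‖ ≤ C_k R⁻¹ (f_R ∘ φᵗ)(ρ)`,
uniformly in `R ≥ 1` and `t ∈ [-T,T]`. -/
theorem stmt_13 (d : ℕ) (hd : 1 ≤ d) (V : E d → ℝ) (m : ℝ) (hV : AssumptionA V m)
    (φ : ℝ → E d × E d → E d × E d) (hφ : IsHamFlow V φ)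
    (T : ℝ) (hT : 0 < T) (ν : ℝ) (hν : 1 / 2 < ν) (k : ℕ) (hk : 1 ≤ k) :
    ∃ Ck > 0, ∀ R : ℝ, 1 ≤ R → ∀ t ∈ Set.Icc (-T) T, ∀ ρ : E d × E d,
      ‖iteratedFDeriv ℝ k (fun σ => fR V ν R (φ t σ)) ρ‖ ≤
        Ck * R⁻¹ * fR V ν R (φ t ρ) := by
  have hV' := hV
  obtain ⟨hVs, hV0, -⟩ := hV'
  obtain ⟨hφs, hφ0, hφd⟩ := hφ
  obtain ⟨hX, hXb⟩ := aux_field hV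
  have hφt : ∀ t, ContDiff ℝ (⊤ : ℕ∞) (φ t) := fun t =>
    hφs.comp (contDiff_const.prodMk contDiff_id)
  -- bounds on the derivatives of the flow
  obtain ⟨B, hB1, hB⟩ := aux_unif (P := fun i C => ∀ t ∈ Set.Icc (-T) T, ∀ ρ,
      ‖iteratedFDeriv ℝ i (φ t) ρ‖ ≤ C)
    (fun i a b hab h t ht ρ => (h t ht ρ).trans hab)
    (fun i hi => aux_flow _ hX hXb φ hφs hφ0 hφd T i hi) k
  -- symbol bounds for the two factors
  have hham : ∀ p, 0 ≤ ham V p := fun p => by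
    have := hV0 p.1
    unfold ham; positivity
  have hhs : ∀ R : ℝ, ContDiff ℝ (⊤ : ℕ∞) (fun ρ : E d × E d => R ^ 2 + ham V ρ) := fun R =>
    contDiff_const.add ((contDiff_const.mul ((contDiff_norm_sq ℝ).comp contDiff_snd)).add
      (hVs.comp contDiff_fst))
  have hws : ∀ R : ℝ, ContDiff ℝ (⊤ : ℕ∞) (fun ρ : E d × E d => 1 + ‖R⁻¹ • ρ.1‖ ^ 2) := fun R =>
    contDiff_const.add ((contDiff_norm_sq ℝ).comp (contDiff_fst.const_smul R⁻¹))
  have hwpos : ∀ (R : ℝ) (p : E d × E d), 0 < 1 + ‖R⁻¹ • p.1‖ ^ 2 := fun R p => by positivity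
  have hhpos : ∀ (R : ℝ) (p : E d × E d), 1 ≤ R → 0 < R ^ 2 + ham V p := fun R p hR => by
    have := hham p
    positivity
  have hh : ∀ i, 1 ≤ i → ∃ K, ∀ R : ℝ, 1 ≤ R → ∀ p : E d × E d,
      ‖iteratedFDeriv ℝ i (fun ρ : E d × E d => (R ^ 2 + ham V ρ) ^ (1 / 2 : ℝ)) p‖ ≤
        K * R⁻¹ * (R ^ 2 + ham V p) ^ (1 / 2 : ℝ) := by
    intro i hi
    obtain ⟨M, hM1, hM⟩ := aux_unif (P := fun i C => ∀ R : ℝ, 1 ≤ R → ∀ p : E d × E d,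
      ‖iteratedFDeriv ℝ i (fun ρ : E d × E d => R ^ 2 + ham V ρ) p‖ ≤ C * R⁻¹ * (R ^ 2 + ham V p))
      (fun i a b hab h R hR p => (h R hR p).trans (by
        have := (hhpos R p hR).le
        gcongr)) (fun i hi => aux_ham hV i hi) i
    obtain ⟨K, hK0, hK⟩ := aux_pow (P := E d × E d) (1 / 2) i hi M hM1
    exact ⟨K, fun R hR p => hK _ (hhs R) (fun y => hhpos R y hR) R⁻¹ (by positivity)
      (inv_le_one_of_one_le₀ hR) p (fun j h1 h2 => hM j h1 h2 R hR p)⟩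
  have hw : ∀ i, 1 ≤ i → ∃ K, ∀ R : ℝ, 1 ≤ R → ∀ p : E d × E d,
      ‖iteratedFDeriv ℝ i (fun ρ : E d × E d => (1 + ‖R⁻¹ • ρ.1‖ ^ 2) ^ (-ν)) p‖ ≤
        K * R⁻¹ * (1 + ‖R⁻¹ • p.1‖ ^ 2) ^ (-ν) := by
    intro i hi
    obtain ⟨K, hK0, hK⟩ := aux_pow (P := E d × E d) (-ν) i hi 4 (by norm_num)
    exact ⟨K, fun R hR p => hK _ (hws R) (hwpos R) R⁻¹ (by positivity)
      (inv_le_one_of_one_le₀ hR) p (fun j h1 h2 => aux_wt j h1 R hR p)⟩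
  obtain ⟨M₁, hM₁, hh'⟩ := aux_unif (P := fun i K => ∀ R : ℝ, 1 ≤ R → ∀ p : E d × E d,
      ‖iteratedFDeriv ℝ i (fun ρ : E d × E d => (R ^ 2 + ham V ρ) ^ (1 / 2 : ℝ)) p‖ ≤
        K * R⁻¹ * (R ^ 2 + ham V p) ^ (1 / 2 : ℝ))
    (fun i a b hab h R hR p => (h R hR p).trans (by
      have := Real.rpow_nonneg (hhpos R p hR).le (1 / 2)
      gcongr)) hh k
  obtain ⟨M₂, hM₂, hw'⟩ := aux_unif (P := fun i K => ∀ R : ℝ, 1 ≤ R → ∀ p : E d × E d,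
      ‖iteratedFDeriv ℝ i (fun ρ : E d × E d => (1 + ‖R⁻¹ • ρ.1‖ ^ 2) ^ (-ν)) p‖ ≤
        K * R⁻¹ * (1 + ‖R⁻¹ • p.1‖ ^ 2) ^ (-ν))
    (fun i a b hab h R hR p => (h R hR p).trans (by gcongr)) hw k
  set M := max M₁ M₂ with hMdef
  have hM1 : 1 ≤ M := le_max_of_le_left hM₁
  have hfeq : ∀ R, fR V ν R = fun ρ : E d × E d =>
      (1 + ‖R⁻¹ • ρ.1‖ ^ 2) ^ (-ν) * (R ^ 2 + ham V ρ) ^ (1 / 2 : ℝ) := fun R => by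
    ext ρ; simp only [fR, Real.sqrt_eq_rpow]
  have hs1 : ∀ R : ℝ, 1 ≤ R → ContDiff ℝ (⊤ : ℕ∞)
      (fun ρ : E d × E d => (R ^ 2 + ham V ρ) ^ (1 / 2 : ℝ)) := fun R hR =>
    (hhs R).rpow_const_of_ne (fun p => (hhpos R p hR).ne')
  have hs2 : ∀ R : ℝ, ContDiff ℝ (⊤ : ℕ∞)
      (fun ρ : E d × E d => (1 + ‖R⁻¹ • ρ.1‖ ^ 2) ^ (-ν)) := fun R =>
    (hws R).rpow_const_of_ne (fun p => (hwpos R p).ne')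
  have hfpos : ∀ R : ℝ, 1 ≤ R → ∀ p, 0 < fR V ν R p := fun R hR p => by
    rw [hfeq]
    exact mul_pos (Real.rpow_pos_of_pos (hwpos R p) _) (Real.rpow_pos_of_pos (hhpos R p hR) _)
  have hfs : ∀ R : ℝ, 1 ≤ R → ContDiff ℝ (⊤ : ℕ∞) (fR V ν R) := fun R hR => by
    rw [hfeq]; exact (hs2 R).mul (hs1 R hR)
  have hf : ∀ i, 1 ≤ i → i ≤ k → ∀ R : ℝ, 1 ≤ R → ∀ p : E d × E d,
      ‖iteratedFDeriv ℝ i (fR V ν R) p‖ ≤ 2 ^ k * M ^ 2 * R⁻¹ * fR V ν R p := by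
    intro i hi hik R hR p
    have key := aux_mul i hi M hM1 _ _ (hs2 R) (hs1 R hR)
      (fun p => Real.rpow_pos_of_pos (hwpos R p) _) (fun p => Real.rpow_pos_of_pos (hhpos R p hR) _)
      R⁻¹ (by positivity) (inv_le_one_of_one_le₀ hR) p
      (fun j h1 h2 => (hw' j h1 (h2.trans hik) R hR p).trans (by
        have := le_max_right M₁ M₂
        gcongr))
      (fun j h1 h2 => (hh' j h1 (h2.trans hik) R hR p).trans (by
        have := le_max_left M₁ M₂
        have := Real.rpow_nonneg (hhpos R p hR).le (1 / 2)
        gcongr))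
    have h9 := (hfpos R hR p).le
    rw [hfeq] at h9 ⊢
    refine key.trans ?_
    have h10 : (2:ℝ) ^ i ≤ 2 ^ k := pow_le_pow_right₀ (by norm_num) hik
    exact mul_le_mul_of_nonneg_right (by gcongr) h9
  refine ⟨k.factorial * (2 ^ k * M ^ 2) * B ^ k, by positivity, fun R hR t ht ρ => ?_⟩
  have hp := hfpos R hR (φ t ρ)
  have := aux_comp (hfs R hR) (hφt t) hk ρ (C := 2 ^ k * M ^ 2 * R⁻¹ * fR V ν R (φ t ρ)) (D := B)
    (by positivity) (fun i h1 h2 => hf i h1 h2 R hR _)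
    (fun i h1 h2 => (hB i h1 h2 t ht ρ).trans (le_self_pow₀ hB1 (by omega)))
  refine this.trans (le_of_eq ?_)
  ring

end
end
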